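/- arXiv:2510.18653 — 13 statements merged into one kernel-verified Lean document; each statement's English description precedes it below -/
import Mathlib

section
/- Let V1, V2, V3 be real vector spaces, let d1 : V1 → V2, d2 : V2 → V3, K : V2 → V1 and P : V2 → V2 be linear maps, let b11 : V1 × V1 → V2 be a symmetric bilinear map and b21 : V2 × V1 → V3 a bilinear map, and assume: (i) d1 ∘ K + K ∘ d2 = id_{V2} − P; (ii) d2(b11(x,y)) = b21(d1 x, y) + b21(d1 y, x) for all x, y ∈ V1; (iii) b21(b11(x,y), z) + b21(b11(y,z), x) + b21(b11(z,x), y) = 0 for all x, y, z ∈ V1. Fix α ∈ V1 with d1 α = 0 and define a_1 = α and, for n ≥ 2, S_n = Σ_{j=1}^{n−1} b11(a_j, a_{n−j}) and a_n = −(1/2)·K(S_n). If P(S_n) = 0 for every n ≥ 2, then d1 a_n = −(1/2)·S_n for every n ≥ 1 (with S_1 = 0); in other words, the recursively defined formal deformation solves the Maurer–Cartan equation order by order. -/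
/-- A sum over the compositions `n = i + (j - i) + (n - j)` of `n` into three positive parts is
invariant under cyclic rotation of the parts. -/
theorem Finset.sum_Ico_sum_Ico_rotate {M : Type*} [AddCommMonoid M] (F : ℕ → ℕ → ℕ → M) (n : ℕ) :
    ∑ j ∈ Finset.Ico 1 n, ∑ i ∈ Finset.Ico 1 j, F i (j - i) (n - j) =
      ∑ j ∈ Finset.Ico 1 n, ∑ i ∈ Finset.Ico 1 j, F (n - j) i (j - i) := by
  rw [Finset.sum_sigma', Finset.sum_sigma']
  refine Finset.sum_bij' (fun p _ => ⟨n - p.2, p.1 - p.2⟩) (fun p _ => ⟨n - p.1 + p.2, n - p.1⟩)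
    ?_ ?_ ?_ ?_ ?_
  · rintro ⟨j, i⟩ h
    simp only [Finset.mem_sigma, Finset.mem_Ico] at h ⊢
    omega
  · rintro ⟨j, i⟩ h
    simp only [Finset.mem_sigma, Finset.mem_Ico] at h ⊢
    omega
  · rintro ⟨j, i⟩ h
    simp only [Finset.mem_sigma, Finset.mem_Ico] at h
    simp only [Sigma.mk.injEq, heq_eq_eq]
    omega
  · rintro ⟨j, i⟩ h
    simp only [Finset.mem_sigma, Finset.mem_Ico] at h
    simp only [Sigma.mk.injEq, heq_eq_eq]
    omega
  · rintro ⟨j, i⟩ h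
    simp only [Finset.mem_sigma, Finset.mem_Ico] at h
    have h₁ : n - (n - i) = i := by omega
    have h₂ : n - i - (j - i) = n - j := by omega
    simp only [h₁, h₂]

/-- If the cyclic sums of `F` vanish, then so does the sum of `F` over the compositions of `n` into
three positive parts. -/
theorem Finset.sum_Ico_sum_Ico_eq_zero_of_cyclic {M : Type*} [AddCommGroup M] [Module ℝ M]
    (F : ℕ → ℕ → ℕ → M) (hF : ∀ i j k, F i j k + F j k i + F k i j = 0) (n : ℕ) :
    ∑ j ∈ Finset.Ico 1 n, ∑ i ∈ Finset.Ico 1 j, F i (j - i) (n - j) = 0 := by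
  have h₁ := Finset.sum_Ico_sum_Ico_rotate F n
  have h₂ := Finset.sum_Ico_sum_Ico_rotate (fun i j k => F k i j) n
  have h₃ : ∑ j ∈ Finset.Ico 1 n, ∑ i ∈ Finset.Ico 1 j,
      (F i (j - i) (n - j) + F (j - i) (n - j) i + F (n - j) i (j - i)) = 0 := by
    simp only [hF, Finset.sum_const_zero]
  simp only [Finset.sum_add_distrib] at h₃
  rw [← h₂, ← h₁] at h₃
  have h₄ : (3 : ℝ) • ∑ j ∈ Finset.Ico 1 n, ∑ i ∈ Finset.Ico 1 j, F i (j - i) (n - j) = 0 := by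
    rw [← h₃]
    module
  exact (smul_eq_zero.mp h₄).resolve_left (by norm_num)


/-- At a smooth point (vanishing induced L∞ operations, encoded by `hP`), the
recursively defined formal deformation solves the Maurer–Cartan equation order
by order: `d1 (a n) = -(1/2) • S n` for all `n ≥ 1`.  Here `K` (with its
degree-shifted component `K'`) is the chain homotopy of SDR data:
`d1 ∘ K + K' ∘ d2 = id - P`. -/
theorem stmt0
    {V1 V2 V3 : Type*}
    [AddCommGroup V1] [Module ℝ V1]
    [AddCommGroup V2] [Module ℝ V2]
    [AddCommGroup V3] [Module ℝ V3]
    (d1 : V1 →ₗ[ℝ] V2) (d2 : V2 →ₗ[ℝ] V3)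
    (K : V2 →ₗ[ℝ] V1) (K' : V3 →ₗ[ℝ] V2) (P : V2 →ₗ[ℝ] V2)
    (b11 : V1 →ₗ[ℝ] V1 →ₗ[ℝ] V2) (b21 : V2 →ₗ[ℝ] V1 →ₗ[ℝ] V3)
    (hb11symm : ∀ x y : V1, b11 x y = b11 y x)
    (hhomotopy : ∀ v : V2, d1 (K v) + K' (d2 v) = v - P v)
    (hLeibniz : ∀ x y : V1, d2 (b11 x y) = b21 (d1 x) y + b21 (d1 y) x)
    (hJacobi : ∀ x y z : V1,
      b21 (b11 x y) z + b21 (b11 y z) x + b21 (b11 z x) y = 0)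
    (α : V1) (hα : d1 α = 0)
    (a : ℕ → V1) (S : ℕ → V2)
    (hS : ∀ n : ℕ, S n = ∑ j ∈ Finset.Ico 1 n, b11 (a j) (a (n - j)))
    (ha1 : a 1 = α)
    (haRec : ∀ n : ℕ, 2 ≤ n → a n = -((1/2 : ℝ) • K (S n)))
    (hP : ∀ n : ℕ, 2 ≤ n → P (S n) = 0) :
    ∀ n : ℕ, 1 ≤ n → d1 (a n) = -((1/2 : ℝ) • S n) := by
  intro n
  induction n using Nat.strong_induction_on with
  | _ n ih =>
  intro hn
  obtain rfl | hn : n = 1 ∨ 2 ≤ n := by omega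
  · simp [hS, ha1, hα]
  have hflip : ∑ j ∈ Finset.Ico 1 n, b21 (d1 (a (n - j))) (a j) =
      ∑ j ∈ Finset.Ico 1 n, b21 (d1 (a j)) (a (n - j)) := by
    refine Finset.sum_bij' (fun j _ => n - j) (fun j _ => n - j) ?_ ?_ ?_ ?_ ?_ <;> intro j hj <;>
      rw [Finset.mem_Ico] at hj
    · rw [Finset.mem_Ico]; omega
    · rw [Finset.mem_Ico]; omega
    · omega
    · omega
    · rw [Nat.sub_sub_self hj.2.le]
  have hsum : ∑ j ∈ Finset.Ico 1 n, b21 (d1 (a j)) (a (n - j)) = 0 := by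
    have hj : ∀ j ∈ Finset.Ico 1 n, b21 (d1 (a j)) (a (n - j)) =
        -((1/2 : ℝ) • ∑ i ∈ Finset.Ico 1 j, b21 (b11 (a i) (a (j - i))) (a (n - j))) := by
      intro j hj
      rw [Finset.mem_Ico] at hj
      rw [ih j hj.2 hj.1, hS]
      simp only [map_neg, map_smul, map_sum, LinearMap.neg_apply, LinearMap.smul_apply,
        LinearMap.sum_apply]
    rw [Finset.sum_congr rfl hj, Finset.sum_neg_distrib, ← Finset.smul_sum,
      Finset.sum_Ico_sum_Ico_eq_zero_of_cyclic (fun i j k => b21 (b11 (a i) (a j)) (a k))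
        (fun i j k => hJacobi (a i) (a j) (a k)), smul_zero, neg_zero]
  have hclosed : d2 (S n) = 0 := by
    rw [hS, map_sum]
    simp only [hLeibniz, Finset.sum_add_distrib]
    rw [hflip, hsum, add_zero]
  have hK : d1 (K (S n)) = S n := by
    simpa [hclosed, hP n hn] using hhomotopy (S n)
  rw [haRec n hn, map_neg, map_smul, hK]
end

section
/- Let E be a real normed vector space, b : E × E → E a bilinear map and K : E → E a linear map such that ‖b(x,y)‖ ≤ C·‖x‖·‖y‖ and ‖K(y)‖ ≤ L·‖y‖ for all x, y and some constants C, L ≥ 0. Given α ∈ E, define a_1 = α and, for n ≥ 2, a_n = −(1/2)·K(Σ_{j=1}^{n−1} b(a_j, a_{n−j})). Then for every n ≥ 1, ‖a_n‖ ≤ catalan(n−1) · (L·C/2)^{n−1} · ‖α‖^n, where catalan(m) denotes the m-th Catalan number. -/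
/-- The Catalan recursion as a sum over the size of the left subtree of a binary tree. -/
lemma catalan_succ_eq_sum_range (m : ℕ) :
    catalan (m + 1) = ∑ i ∈ Finset.range (m + 1), catalan i * catalan (m - i) := by
  rw [catalan_succ, Fin.sum_univ_eq_sum_range (fun i ↦ catalan i * catalan (m - i))]

/-- Catalan-number bound for the coefficients of the sum-over-trees formal
deformation: `‖a n‖ ≤ catalan (n-1) * (L*C/2)^(n-1) * ‖α‖^n` for `n ≥ 1`. -/
theorem stmt1
    {E : Type*} [NormedAddCommGroup E] [NormedSpace ℝ E]
    (b : E →ₗ[ℝ] E →ₗ[ℝ] E) (K : E →ₗ[ℝ] E)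
    (C L : ℝ) (hC : 0 ≤ C) (hL : 0 ≤ L)
    (hb : ∀ x y : E, ‖b x y‖ ≤ C * ‖x‖ * ‖y‖)
    (hK : ∀ y : E, ‖K y‖ ≤ L * ‖y‖)
    (α : E) (a : ℕ → E)
    (ha1 : a 1 = α)
    (haRec : ∀ n : ℕ, 2 ≤ n →
      a n = -((1/2 : ℝ) • K (∑ j ∈ Finset.Ico 1 n, b (a j) (a (n - j))))) :
    ∀ n : ℕ, 1 ≤ n →
      ‖a n‖ ≤ (catalan (n - 1) : ℝ) * (L * C / 2) ^ (n - 1) * ‖α‖ ^ n := by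
  intro n
  induction n using Nat.strong_induction_on with
  | _ n ih =>
  intro hn
  obtain rfl | ⟨m, rfl⟩ : n = 1 ∨ ∃ m, n = m + 2 := by
    rcases hn.eq_or_lt with h | h
    · exact Or.inl h.symm
    · exact Or.inr ⟨n - 2, by omega⟩
  · simp [ha1]
  have hterm : ∀ i ∈ Finset.range (m + 1), ‖b (a (1 + i)) (a (m + 2 - (1 + i)))‖ ≤
      (catalan i * catalan (m - i) : ℝ) * (C * (L * C / 2) ^ m * ‖α‖ ^ (m + 2)) := by
    intro i hi
    obtain ⟨k, rfl⟩ := Nat.exists_eq_add_of_le (Finset.mem_range_succ_iff.mp hi)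
    have hleft := ih (1 + i) (by omega) (by omega)
    have hright := ih (1 + k) (by omega) (by omega)
    rw [Nat.add_sub_cancel_left] at hleft hright
    rw [show i + k + 2 - (1 + i) = 1 + k by omega, Nat.add_sub_cancel_left]
    calc ‖b (a (1 + i)) (a (1 + k))‖ ≤ C * ‖a (1 + i)‖ * ‖a (1 + k)‖ := hb _ _
      _ ≤ C * (catalan i * (L * C / 2) ^ i * ‖α‖ ^ (1 + i)) *
          (catalan k * (L * C / 2) ^ k * ‖α‖ ^ (1 + k)) := by gcongr
      _ = _ := by ring
  have hsum : ‖∑ j ∈ Finset.Ico 1 (m + 2), b (a j) (a (m + 2 - j))‖ ≤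
      (catalan (m + 1) : ℝ) * (C * (L * C / 2) ^ m * ‖α‖ ^ (m + 2)) := by
    rw [Finset.sum_Ico_eq_sum_range, catalan_succ_eq_sum_range]
    push_cast
    rw [Finset.sum_mul]
    exact norm_sum_le_of_le _ hterm
  rw [haRec (m + 2) (by omega), norm_neg, norm_smul, Real.norm_of_nonneg (by norm_num)]
  calc (1 / 2 : ℝ) * ‖K (∑ j ∈ Finset.Ico 1 (m + 2), b (a j) (a (m + 2 - j)))‖
      ≤ 1 / 2 * (L * (catalan (m + 1) * (C * (L * C / 2) ^ m * ‖α‖ ^ (m + 2)))) := by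
        gcongr
        exact (hK _).trans (by gcongr)
    _ = catalan (m + 2 - 1) * (L * C / 2) ^ (m + 2 - 1) * ‖α‖ ^ (m + 2) := by
        rw [show m + 2 - 1 = m + 1 by omega]
        ring
end

section
/- Let E be a real Banach space, b : E × E → E a bilinear map and K : E → E a linear map with ‖b(x,y)‖ ≤ C·‖x‖·‖y‖ and ‖K(y)‖ ≤ L·‖y‖ for all x, y and constants C, L ≥ 0. Given α ∈ E define a_1 = α and a_n = −(1/2)·K(Σ_{j=1}^{n−1} b(a_j, a_{n−j})) for n ≥ 2. If 2·L·C·‖α‖ < 1, then Σ_{n≥1} ‖a_n‖ < ∞; in particular the series δ̃(α) = Σ_{n≥1} a_n converges absolutely in E. -/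
/-- Catalan numbers grow at most like powers of four. -/
theorem catalan_le_four_pow (n : ℕ) : catalan n ≤ 4 ^ n :=
  calc catalan n ≤ (n + 1) * catalan n := Nat.le_mul_of_pos_left _ n.succ_pos
    _ = n.centralBinom := succ_mul_catalan_eq_centralBinom n
    _ ≤ 4 ^ n := n.centralBinom_le_four_pow

/-- A sequence satisfying a quadratic recursion through a bounded bilinear map and a bounded
linear map is bounded by Catalan numbers times a geometric sequence. -/
theorem norm_le_catalan_of_quadratic_recursion
    {E : Type*} [NormedAddCommGroup E] [NormedSpace ℝ E]
    (b : E →ₗ[ℝ] E →ₗ[ℝ] E) (K : E →ₗ[ℝ] E)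
    {C L : ℝ} (hC : 0 ≤ C) (hL : 0 ≤ L)
    (hb : ∀ x y : E, ‖b x y‖ ≤ C * ‖x‖ * ‖y‖)
    (hK : ∀ y : E, ‖K y‖ ≤ L * ‖y‖)
    {a : ℕ → E}
    (haRec : ∀ n : ℕ, 2 ≤ n →
      a n = -((1/2 : ℝ) • K (∑ j ∈ Finset.Ico 1 n, b (a j) (a (n - j)))))
    (n : ℕ) :
    ‖a (n + 1)‖ ≤ catalan n * (L * C / 2) ^ n * ‖a 1‖ ^ (n + 1) := by
  induction n using Nat.strong_induction_on with
  | _ n ih =>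
    rcases n with _ | n
    · simp
    have hterm : ∀ i ∈ Finset.range (n + 1),
        ‖b (a (i + 1)) (a (n - i + 1))‖ ≤
          C * (L * C / 2) ^ n * ‖a 1‖ ^ (n + 2) * (catalan i * catalan (n - i)) := by
      intro i hi
      have hin : i ≤ n := Nat.lt_succ_iff.mp (Finset.mem_range.mp hi)
      obtain ⟨k, rfl⟩ := Nat.exists_eq_add_of_le hin
      rw [Nat.add_sub_cancel_left]
      calc ‖b (a (i + 1)) (a (k + 1))‖
          ≤ C * ‖a (i + 1)‖ * ‖a (k + 1)‖ := hb _ _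
        _ ≤ C * (catalan i * (L * C / 2) ^ i * ‖a 1‖ ^ (i + 1)) *
              (catalan k * (L * C / 2) ^ k * ‖a 1‖ ^ (k + 1)) := by
            gcongr
            · exact ih i (by omega)
            · exact ih k (by omega)
        _ = _ := by ring
    have hcat : (catalan (n + 1) : ℝ) =
        ∑ i ∈ Finset.range (n + 1), (catalan i : ℝ) * catalan (n - i) := by
      rw [catalan_succ, Nat.cast_sum, Finset.sum_range]
      simp
    have hsum : ∑ j ∈ Finset.Ico 1 (n + 2), b (a j) (a (n + 2 - j)) =
        ∑ i ∈ Finset.range (n + 1), b (a (i + 1)) (a (n - i + 1)) := by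
      rw [Finset.sum_Ico_eq_sum_range]
      refine Finset.sum_congr rfl fun i hi => ?_
      have := Finset.mem_range.mp hi
      rw [add_comm 1 i, show n + 2 - (i + 1) = n - i + 1 by omega]
    rw [haRec (n + 1 + 1) (by omega), hsum, norm_neg, norm_smul,
      Real.norm_of_nonneg (by norm_num : (0 : ℝ) ≤ 1 / 2)]
    calc 1 / 2 * ‖K (∑ i ∈ Finset.range (n + 1), b (a (i + 1)) (a (n - i + 1)))‖
        ≤ 1 / 2 * (L * ∑ i ∈ Finset.range (n + 1),
            C * (L * C / 2) ^ n * ‖a 1‖ ^ (n + 2) * (catalan i * catalan (n - i))) := by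
          gcongr
          refine (hK _).trans ?_
          gcongr
          exact norm_sum_le_of_le _ hterm
      _ = _ := by
          rw [← Finset.mul_sum, ← hcat]
          ring

/-- Absolute convergence of the sum-over-trees deformation series: if
`2*L*C*‖α‖ < 1` then `∑_{n≥1} ‖a n‖ < ∞`. -/
theorem stmt2
    {E : Type*} [NormedAddCommGroup E] [NormedSpace ℝ E] [CompleteSpace E]
    (b : E →ₗ[ℝ] E →ₗ[ℝ] E) (K : E →ₗ[ℝ] E)
    (C L : ℝ) (hC : 0 ≤ C) (hL : 0 ≤ L)
    (hb : ∀ x y : E, ‖b x y‖ ≤ C * ‖x‖ * ‖y‖)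
    (hK : ∀ y : E, ‖K y‖ ≤ L * ‖y‖)
    (α : E) (hsmall : 2 * L * C * ‖α‖ < 1)
    (a : ℕ → E)
    (ha1 : a 1 = α)
    (haRec : ∀ n : ℕ, 2 ≤ n →
      a n = -((1/2 : ℝ) • K (∑ j ∈ Finset.Ico 1 n, b (a j) (a (n - j))))) :
    Summable (fun n : ℕ => ‖a (n + 1)‖) := by
  have hr : 0 ≤ 2 * L * C * ‖α‖ := by positivity
  refine Summable.of_nonneg_of_le (fun _ => norm_nonneg _) (fun n => ?_)
    ((summable_geometric_of_lt_one hr hsmall).mul_left ‖α‖)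
  calc ‖a (n + 1)‖
      ≤ catalan n * (L * C / 2) ^ n * ‖a 1‖ ^ (n + 1) :=
        norm_le_catalan_of_quadratic_recursion b K hC hL hb hK haRec n
    _ ≤ 4 ^ n * (L * C / 2) ^ n * ‖a 1‖ ^ (n + 1) := by
        gcongr
        exact_mod_cast catalan_le_four_pow n
    _ = ‖α‖ * (2 * L * C * ‖α‖) ^ n := by
        rw [ha1, pow_succ, ← mul_assoc, ← mul_pow, ← mul_pow, mul_comm]
        congr 2
        ring
end

section
/- Let E be a real Banach space, b : E × E → E a continuous bilinear map and K : E → E a continuous linear map. Given α ∈ E define a_1 = α and a_n = −(1/2)·K(Σ_{j=1}^{n−1} b(a_j, a_{n−j})) for n ≥ 2, and assume Σ_{n≥1} ‖a_n‖ < ∞. Then the sum D = Σ_{n≥1} a_n satisfies D + (1/2)·K(b(D, D)) = α. In other words, the Kuranishi map κ̃(x) = x + (1/2)·K(b(x,x)) is a left inverse of the summed deformation series: κ̃(δ̃(α)) = α. -/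
open Finset in
/-- The Cauchy product of two absolutely convergent series with respect to a continuous bilinear
map. -/
theorem ContinuousLinearMap.hasSum_sum_antidiagonal_of_summable_norm
    {𝕜 E F G : Type*} [NontriviallyNormedField 𝕜]
    [NormedAddCommGroup E] [NormedSpace 𝕜 E] [CompleteSpace E]
    [NormedAddCommGroup F] [NormedSpace 𝕜 F] [CompleteSpace F]
    [NormedAddCommGroup G] [NormedSpace 𝕜 G] [CompleteSpace G]
    (b : E →L[𝕜] F →L[𝕜] G) {f : ℕ → E} {g : ℕ → F}
    (hf : Summable fun n => ‖f n‖) (hg : Summable fun n => ‖g n‖) :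
    HasSum (fun n => ∑ p ∈ antidiagonal n, b (f p.1) (g p.2)) (b (∑' n, f n) (∑' n, g n)) := by
  have hfg : Summable fun p : ℕ × ℕ => b (f p.1) (g p.2) := by
    refine Summable.of_norm_bounded
      ((hf.mul_of_nonneg hg (fun _ => norm_nonneg _) fun _ => norm_nonneg _).mul_left ‖b‖)
      fun p => ?_
    simpa only [mul_assoc] using b.le_opNorm₂ (f p.1) (g p.2)
  have hprod : ∑' p : ℕ × ℕ, b (f p.1) (g p.2) = b (∑' n, f n) (∑' n, g n) := by
    rw [hfg.tsum_prod, ← ContinuousLinearMap.flip_apply, ContinuousLinearMap.map_tsum _ hf.of_norm]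
    exact tsum_congr fun i => ((b (f i)).map_tsum hg.of_norm).symm
  have hsigma := HasAntidiagonal.sigmaAntidiagonalEquivProd.hasSum_iff.mpr (hprod ▸ hfg.hasSum)
  refine hsigma.sigma fun n => ?_
  rw [← Finset.sum_coe_sort]
  exact hasSum_fintype _

/-- The Kuranishi map `κ̃(x) = x + (1/2)·K(b(x,x))` is a left inverse of the
summed deformation series: the sum `D = Σ_{n≥1} a n` satisfies
`D + (1/2)·K(b(D,D)) = α`. -/
theorem stmt3
    {E : Type*} [NormedAddCommGroup E] [NormedSpace ℝ E] [CompleteSpace E]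
    (b : E →L[ℝ] E →L[ℝ] E) (K : E →L[ℝ] E)
    (α : E) (a : ℕ → E)
    (ha1 : a 1 = α)
    (haRec : ∀ n : ℕ, 2 ≤ n →
      a n = -((1/2 : ℝ) • K (∑ j ∈ Finset.Ico 1 n, b (a j) (a (n - j)))))
    (hsum : Summable (fun n : ℕ => ‖a (n + 1)‖)) :
    (∑' n : ℕ, a (n + 1)) +
      (1/2 : ℝ) • K (b (∑' n : ℕ, a (n + 1)) (∑' n : ℕ, a (n + 1))) = α := by
  have hb := b.hasSum_sum_antidiagonal_of_summable_norm hsum hsum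
  have hrec (n : ℕ) : a (n + 1 + 1) = -((1/2 : ℝ) •
      K (∑ p ∈ Finset.HasAntidiagonal.antidiagonal n, b (a (p.1 + 1)) (a (p.2 + 1)))) := by
    rw [haRec (n + 1 + 1) (by omega), Finset.sum_Ico_eq_sum_range,
      Finset.Nat.sum_antidiagonal_eq_sum_range_succ fun i j => b (a (i + 1)) (a (j + 1))]
    congr 3
    refine Finset.sum_congr rfl fun j hj => ?_
    rw [Finset.mem_range] at hj
    rw [add_comm 1 j, show n + 1 + 1 - (j + 1) = n - j + 1 by omega]
  have htail := ((K.hasSum hb).const_smul (1/2 : ℝ)).neg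
  simp only [← hrec] at htail
  nth_rewrite 1 [hsum.of_norm.tsum_eq_zero_add]
  rw [htail.tsum_eq, zero_add, ha1, neg_add_cancel_right]
end

section
/- Let V1, V2, V3 be real vector spaces, d1 : V1 → V2, d2 : V2 → V3, K : V2 → V1, P : V2 → V2 linear maps, b11 : V1 × V1 → V2 a symmetric bilinear map, b21 : V2 × V1 → V3 a bilinear map, and assume: (i) d1 ∘ K + K ∘ d2 = id_{V2} − P; (ii) P ∘ d1 = 0; (iii) d2(b11(x,y)) = b21(d1 x, y) + b21(d1 y, x) for all x, y ∈ V1; (iv) b21(b11(x,y), z) + b21(b11(y,z), x) + b21(b11(z,x), y) = 0 for all x, y, z ∈ V1. If m ∈ V1 satisfies the Maurer–Cartan equation d1 m + (1/2)·b11(m, m) = 0, then the Kuranishi image of m is closed: d1(m + (1/2)·K(b11(m, m))) = 0. -/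
/-- The Kuranishi map sends Maurer–Cartan elements to closed elements:
if `d1 m + (1/2)•b11 m m = 0` then `d1 (m + (1/2)•K (b11 m m)) = 0`.
Here `K` (with degree-shifted component `K'`) is the chain homotopy
`d1 ∘ K + K' ∘ d2 = id - P`, and `P` annihilates `d1`-exact elements. -/
theorem stmt5
    {V1 V2 V3 : Type*}
    [AddCommGroup V1] [Module ℝ V1]
    [AddCommGroup V2] [Module ℝ V2]
    [AddCommGroup V3] [Module ℝ V3]
    (d1 : V1 →ₗ[ℝ] V2) (d2 : V2 →ₗ[ℝ] V3)
    (K : V2 →ₗ[ℝ] V1) (K' : V3 →ₗ[ℝ] V2) (P : V2 →ₗ[ℝ] V2)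
    (b11 : V1 →ₗ[ℝ] V1 →ₗ[ℝ] V2) (b21 : V2 →ₗ[ℝ] V1 →ₗ[ℝ] V3)
    (hb11symm : ∀ x y : V1, b11 x y = b11 y x)
    (hhomotopy : ∀ v : V2, d1 (K v) + K' (d2 v) = v - P v)
    (hPd : ∀ x : V1, P (d1 x) = 0)
    (hLeibniz : ∀ x y : V1, d2 (b11 x y) = b21 (d1 x) y + b21 (d1 y) x)
    (hJacobi : ∀ x y z : V1,
      b21 (b11 x y) z + b21 (b11 y z) x + b21 (b11 z x) y = 0)
    (m : V1) (hMC : d1 m + (1/2 : ℝ) • b11 m m = 0) :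
    d1 (m + (1/2 : ℝ) • K (b11 m m)) = 0 := by
  have hd1 : d1 m = (-(1/2) : ℝ) • b11 m m := by
    rw [neg_smul]
    exact eq_neg_of_add_eq_zero_left hMC
  have hB : b11 m m = (-2 : ℝ) • d1 m := by
    rw [hd1, smul_smul]
    norm_num
  have hbracket : b21 (b11 m m) m = 0 := by
    have h3 : (3 : ℝ) • b21 (b11 m m) m = 0 := by
      rw [← hJacobi m m m]
      module
    exact (smul_eq_zero.mp h3).resolve_left (by norm_num)
  have hd2 : d2 (b11 m m) = 0 := by
    rw [hLeibniz, hd1, map_smul, LinearMap.smul_apply, hbracket, smul_zero, add_zero]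
  have hP : P (b11 m m) = 0 := by
    rw [hB, map_smul, hPd, smul_zero]
  have hK : d1 (K (b11 m m)) = b11 m m := by
    simpa [hd2, hP] using hhomotopy (b11 m m)
  rw [map_add, map_smul, hK, hMC]
end

section
/- Let V1, V2 and W0, W1, W2 be real vector spaces, with linear maps d1 : V1 → V2, e0 : W0 → W1, e1 : W1 → W2, K_W : W1 → W0, P_W : W1 → W1, and bilinear maps b11 : V1 × V1 → V2 (symmetric), c0 : V1 × W0 → W1, c1 : V1 × W1 → W2, c2 : V2 × W0 → W2, satisfying: (i) e0 ∘ K_W + K_W ∘ e1 = id_{W1} − P_W; (ii) e1(c0(x, w)) = c2(d1 x, w) − c1(x, e0 w) for all x ∈ V1, w ∈ W0; (iii) c2(b11(x, y), w) = c1(x, c0(y, w)) + c1(y, c0(x, w)) for all x, y ∈ V1, w ∈ W0. Let (a_n)_{n≥1} be a sequence in V1 satisfying d1 a_n = −(1/2)·Σ_{j=1}^{n−1} b11(a_j, a_{n−j}) for all n ≥ 1, and let χ ∈ W0 with e0 χ = 0. Define χ^0 = χ and, for n ≥ 1, T_n = Σ_{k=1}^{n} c0(a_k, χ^{n−k}) and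 χ^n = −K_W(T_n). If P_W(T_n) = 0 for every n ≥ 1, then e0 χ^n = −T_n for every n ≥ 0 (with T_0 = 0); equivalently, the formal series χ_t = Σ_{n≥0} t^n χ^n is annihilated, order by order in t, by the deformed differential e0 + Σ_{n≥1} t^n c0(a_n, ·). -/
/-- Reindexing a sum over the positive pairs `(j, l)` with `j + l ≤ n` by their total. -/
theorem sum_Icc_sum_Ico_sub {M : Type*} [AddCommMonoid M] (F : ℕ → ℕ → M) (n : ℕ) :
    ∑ k ∈ Finset.Icc 1 n, ∑ j ∈ Finset.Ico 1 k, F j (k - j) =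
      ∑ j ∈ Finset.Icc 1 n, ∑ l ∈ Finset.Icc 1 (n - j), F j l := by
  rw [Finset.sum_sigma', Finset.sum_sigma']
  refine Finset.sum_bij' (fun p _ => ⟨p.2, p.1 - p.2⟩) (fun p _ => ⟨p.1 + p.2, p.1⟩) ?_ ?_ ?_ ?_ ?_
  · rintro ⟨k, j⟩ h
    simp only [Finset.mem_sigma, Finset.mem_Icc, Finset.mem_Ico] at h ⊢
    omega
  · rintro ⟨j, l⟩ h
    simp only [Finset.mem_sigma, Finset.mem_Icc, Finset.mem_Ico] at h ⊢
    omega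
  · rintro ⟨k, j⟩ h
    simp only [Finset.mem_sigma, Finset.mem_Icc, Finset.mem_Ico] at h
    have hk : j + (k - j) = k := by omega
    simp [hk]
  · rintro ⟨j, l⟩ _
    simp
  · rintro ⟨k, j⟩ _
    rfl

theorem sum_Ico_one_reflect {M : Type*} [AddCommMonoid M] (F : ℕ → ℕ → M) (k : ℕ) :
    ∑ j ∈ Finset.Ico 1 k, F (k - j) j = ∑ j ∈ Finset.Ico 1 k, F j (k - j) := by
  refine Finset.sum_bij' (fun j _ => k - j) (fun j _ => k - j) ?_ ?_ ?_ ?_ ?_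
  all_goals
    intro j h
    rw [Finset.mem_Ico] at h
  · rw [Finset.mem_Ico]; omega
  · rw [Finset.mem_Ico]; omega
  · omega
  · omega
  · rw [Nat.sub_sub_self h.2.le]


/-- Transporting "harmonic" elements along a formal path of Maurer–Cartan
solutions: the recursively defined corrections `χ n` satisfy
`e0 (χ n) = -(T n)` for all `n ≥ 0`, i.e. the formal series `Σ tⁿ χ n` is
annihilated order by order by the deformed differential `e0 + Σ tⁿ c0(a n, ·)`. -/
theorem stmt7
    {V1 V2 W0 W1 W2 : Type*}
    [AddCommGroup V1] [Module ℝ V1] [AddCommGroup V2] [Module ℝ V2]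
    [AddCommGroup W0] [Module ℝ W0] [AddCommGroup W1] [Module ℝ W1]
    [AddCommGroup W2] [Module ℝ W2]
    (d1 : V1 →ₗ[ℝ] V2)
    (e0 : W0 →ₗ[ℝ] W1) (e1 : W1 →ₗ[ℝ] W2)
    (KW : W1 →ₗ[ℝ] W0) (KW' : W2 →ₗ[ℝ] W1) (PW : W1 →ₗ[ℝ] W1)
    (b11 : V1 →ₗ[ℝ] V1 →ₗ[ℝ] V2)
    (c0 : V1 →ₗ[ℝ] W0 →ₗ[ℝ] W1)
    (c1 : V1 →ₗ[ℝ] W1 →ₗ[ℝ] W2)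
    (c2 : V2 →ₗ[ℝ] W0 →ₗ[ℝ] W2)
    (hb11symm : ∀ x y : V1, b11 x y = b11 y x)
    (hhomotopy : ∀ w : W1, e0 (KW w) + KW' (e1 w) = w - PW w)
    (hLeibniz : ∀ (x : V1) (w : W0), e1 (c0 x w) = c2 (d1 x) w - c1 x (e0 w))
    (hJacobi : ∀ (x y : V1) (w : W0),
      c2 (b11 x y) w = c1 x (c0 y w) + c1 y (c0 x w))
    (a : ℕ → V1)
    (haMC : ∀ n : ℕ, 1 ≤ n →
      d1 (a n) = -((1/2 : ℝ) • ∑ j ∈ Finset.Ico 1 n, b11 (a j) (a (n - j))))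
    (χ₀ : W0) (hχ₀ : e0 χ₀ = 0)
    (χ : ℕ → W0) (T : ℕ → W1)
    (hT : ∀ n : ℕ, T n = ∑ k ∈ Finset.Icc 1 n, c0 (a k) (χ (n - k)))
    (hχzero : χ 0 = χ₀)
    (hχRec : ∀ n : ℕ, 1 ≤ n → χ n = -(KW (T n)))
    (hPT : ∀ n : ℕ, 1 ≤ n → PW (T n) = 0) :
    ∀ n : ℕ, e0 (χ n) = -(T n) := by
  intro n
  induction n using Nat.strong_induction_on with
  | _ n ih =>
    rcases Nat.eq_zero_or_pos n with rfl | hn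
    · simp [hT, hχzero, hχ₀]
    have hMC : ∀ k ∈ Finset.Icc 1 n, c2 (d1 (a k)) (χ (n - k)) =
        -∑ j ∈ Finset.Ico 1 k, c1 (a j) (c0 (a (k - j)) (χ (n - j - (k - j)))) := by
      intro k hk
      have hsum : ∑ j ∈ Finset.Ico 1 k, c2 (b11 (a j) (a (k - j))) (χ (n - k)) =
          (2 : ℝ) • ∑ j ∈ Finset.Ico 1 k, c1 (a j) (c0 (a (k - j)) (χ (n - k))) := by
        simp only [hJacobi, Finset.sum_add_distrib]
        rw [sum_Ico_one_reflect (fun i j => c1 (a i) (c0 (a j) (χ (n - k)))), two_smul]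
      rw [haMC k (Finset.mem_Icc.mp hk).1]
      simp only [map_neg, map_smul, map_sum, LinearMap.neg_apply, LinearMap.smul_apply,
        LinearMap.sum_apply]
      rw [hsum, smul_smul, one_div, inv_mul_cancel₀ two_ne_zero, one_smul]
      refine congrArg Neg.neg (Finset.sum_congr rfl fun j hj => ?_)
      rw [Finset.mem_Ico] at hj
      rw [show n - j - (k - j) = n - k by omega]
    have hc1 : ∀ k ∈ Finset.Icc 1 n, c1 (a k) (e0 (χ (n - k))) =
        -∑ l ∈ Finset.Icc 1 (n - k), c1 (a k) (c0 (a l) (χ (n - k - l))) := by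
      intro k hk
      rw [Finset.mem_Icc] at hk
      rw [ih (n - k) (by omega), hT, map_neg, map_sum]
    have hclosed : e1 (T n) = 0 := by
      rw [hT, map_sum]
      simp only [hLeibniz]
      rw [Finset.sum_sub_distrib, Finset.sum_congr rfl hMC, Finset.sum_congr rfl hc1,
        Finset.sum_neg_distrib, Finset.sum_neg_distrib,
        sum_Icc_sum_Ico_sub (fun j l => c1 (a j) (c0 (a l) (χ (n - j - l)))), sub_self]
    have hK := hhomotopy (T n)
    rw [hclosed, map_zero, add_zero, hPT n hn, sub_zero] at hK
    rw [hχRec n hn, map_neg, hK]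
end

section
/- Let V1 and W0, W1, W2, W3 be real vector spaces with linear maps e0 : W0 → W1, e1 : W1 → W2, e2 : W2 → W3, K1 : W1 → W0, K2 : W2 → W1, K3 : W3 → W2, P1 : W1 → W1, P2 : W2 → W2, and bilinear maps c0 : V1 × W0 → W1, c1 : V1 × W1 → W2, c2 : V1 × W2 → W3. Fix x ∈ V1 and assume: (i) e0 ∘ K1 + K2 ∘ e1 = id_{W1} − P1 and e1 ∘ K2 + K3 ∘ e2 = id_{W2} − P2; (ii) e1 ∘ P1 = 0; (iii) e1(c0(x, w)) = −c1(x, e0 w) for all w ∈ W0, and e2(c1(x, w')) = −c2(x, e1 w') for all w' ∈ W1; (iv) P2(c1(x, P1 w')) = 0 for all w' ∈ W1. Then for every y ∈ W1 with e1 y = 0, the element c1(x, y) lies in the range of e1; explicitly, c1(x, y) = e1( K2(c1(x, P1 y)) − c0(x, K1 y) ). -/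
/-- At a smooth point, `c1(x,·)` (the bracket with a closed element `x`) maps
closed elements to exact ones, with explicit primitive:
`c1 x y = e1 (K2 (c1 x (P1 y)) - c0 x (K1 y))` whenever `e1 y = 0`. -/
theorem stmt8
    {V1 W0 W1 W2 W3 : Type*}
    [AddCommGroup V1] [Module ℝ V1]
    [AddCommGroup W0] [Module ℝ W0] [AddCommGroup W1] [Module ℝ W1]
    [AddCommGroup W2] [Module ℝ W2] [AddCommGroup W3] [Module ℝ W3]
    (e0 : W0 →ₗ[ℝ] W1) (e1 : W1 →ₗ[ℝ] W2) (e2 : W2 →ₗ[ℝ] W3)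
    (K1 : W1 →ₗ[ℝ] W0) (K2 : W2 →ₗ[ℝ] W1) (K3 : W3 →ₗ[ℝ] W2)
    (P1 : W1 →ₗ[ℝ] W1) (P2 : W2 →ₗ[ℝ] W2)
    (c0 : V1 →ₗ[ℝ] W0 →ₗ[ℝ] W1)
    (c1 : V1 →ₗ[ℝ] W1 →ₗ[ℝ] W2)
    (c2 : V1 →ₗ[ℝ] W2 →ₗ[ℝ] W3)
    (x : V1)
    (hhomotopy1 : ∀ w : W1, e0 (K1 w) + K2 (e1 w) = w - P1 w)
    (hhomotopy2 : ∀ w : W2, e1 (K2 w) + K3 (e2 w) = w - P2 w)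
    (hP1closed : ∀ w : W1, e1 (P1 w) = 0)
    (hLeibniz0 : ∀ w : W0, e1 (c0 x w) = -(c1 x (e0 w)))
    (hLeibniz1 : ∀ w : W1, e2 (c1 x w) = -(c2 x (e1 w)))
    (hsmooth : ∀ w : W1, P2 (c1 x (P1 w)) = 0) :
    ∀ y : W1, e1 y = 0 →
      c1 x y = e1 (K2 (c1 x (P1 y)) - c0 x (K1 y)) := by
  intro y hy
  have hclosed : e2 (c1 x (P1 y)) = 0 := by
    rw [hLeibniz1, hP1closed, map_zero, neg_zero]
  have hharmonic : e1 (K2 (c1 x (P1 y))) = c1 x (P1 y) := by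
    simpa [hclosed, hsmooth] using hhomotopy2 (c1 x (P1 y))
  have hexact : e0 (K1 y) = y - P1 y := by
    simpa [hy] using hhomotopy1 y
  rw [map_sub, hharmonic, hLeibniz0, hexact, map_sub]
  abel
end

section
/- Let V be a module over a commutative ring and let d, h : V → V be linear endomorphisms with d ∘ d = 0, h ∘ h = 0, and such that H := d ∘ h + h ∘ d is bijective. Then: (a) ker d ∩ ker h = {0}; (b) ker d = range d and ker h = range h; (c) V is the internal direct sum of range d and range h, i.e. range d ∩ range h = {0} and range d + range h = V. -/
/-- If `d² = 0` and `d ∘ h + h ∘ d` is bijective, then `d` is exact. -/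
theorem LinearMap.ker_eq_range_of_bijective_comp_add_comp
    {R V : Type*} [CommRing R] [AddCommGroup V] [Module R V] {d h : V →ₗ[R] V}
    (hd : d ∘ₗ d = 0) (hH : Function.Bijective ⇑(d ∘ₗ h + h ∘ₗ d)) :
    LinearMap.ker d = LinearMap.range d := by
  have hdd (x : V) : d (d x) = 0 := LinearMap.congr_fun hd x
  refine le_antisymm (fun v hv => ?_) (LinearMap.range_le_ker_iff.mpr hd)
  obtain ⟨w, rfl⟩ := hH.surjective v
  have hdhd : d (h (d w)) = 0 := by simpa [hdd] using hv
  have hdw : d w = 0 := by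
    apply hH.injective
    simp [hdd, hdhd]
  exact ⟨h w, by simp [hdw]⟩

/-- Desynchronized Hodge decomposition on the image of an invertible generalized
Laplacian: if `d² = 0`, `h² = 0` and `H = d∘h + h∘d` is bijective, then
`ker d ∩ ker h = 0`, `ker d = range d`, `ker h = range h`, and `V` is the
internal direct sum of `range d` and `range h`. -/
theorem stmt10
    {R V : Type*} [CommRing R] [AddCommGroup V] [Module R V]
    (d h : V →ₗ[R] V)
    (hd : d ∘ₗ d = 0) (hh : h ∘ₗ h = 0)
    (hH : Function.Bijective ⇑(d ∘ₗ h + h ∘ₗ d)) :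
    (LinearMap.ker d ⊓ LinearMap.ker h = ⊥) ∧
    (LinearMap.ker d = LinearMap.range d) ∧
    (LinearMap.ker h = LinearMap.range h) ∧
    (LinearMap.range d ⊓ LinearMap.range h = ⊥) ∧
    (LinearMap.range d ⊔ LinearMap.range h = ⊤) := by
  have hker : LinearMap.ker d ⊓ LinearMap.ker h = ⊥ := by
    refine (Submodule.eq_bot_iff _).mpr fun x hx => hH.injective ?_
    obtain ⟨hdx, hhx⟩ := hx
    rw [SetLike.mem_coe, LinearMap.mem_ker] at hdx hhx
    simp [hdx, hhx]
  have hdr := LinearMap.ker_eq_range_of_bijective_comp_add_comp hd hH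
  have hhr := LinearMap.ker_eq_range_of_bijective_comp_add_comp (d := h) (h := d) hh
    (by rwa [add_comm])
  refine ⟨hker, hdr, hhr, by rwa [← hdr, ← hhr], eq_top_iff.mpr fun v _ => ?_⟩
  obtain ⟨w, rfl⟩ := hH.surjective v
  exact Submodule.add_mem_sup (LinearMap.mem_range_self d (h w))
    (LinearMap.mem_range_self h (d w))
end

section
/- Let V and W be real vector spaces, d : V → V a linear map with d ∘ d = 0, and let (i, p, K) be SDR data of (V, d) onto (W, 0), i.e. d ∘ i = 0, p ∘ d = 0, p ∘ i = id_W, d ∘ K + K ∘ d = id_V − i ∘ p, K ∘ K = 0, K ∘ i = 0, p ∘ K = 0. Let σ, μ, ρ : V → V be arbitrary linear maps and set 𝕀 = K ∘ σ, Λ = K ∘ μ ∘ d ∘ K, ℙ = ρ ∘ d ∘ K. Define, for a formal parameter ε with ε² = 0 (equivalently: modulo ε²), i_ε = i − ε·(d ∘ 𝕀 ∘ i), p_ε = p − ε·(p ∘ ℙ ∘ d), K_ε = K + ε·(d ∘ Λ − Λ ∘ d + i ∘ p ∘ ℙ + 𝕀 ∘ i ∘ p). Then (i_ε, p_ε, K_ε)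 again satisfy all SDR axioms modulo ε²: d ∘ i_ε ≡ 0, p_ε ∘ d ≡ 0, p_ε ∘ i_ε ≡ id_W, d ∘ K_ε + K_ε ∘ d ≡ id_V − i_ε ∘ p_ε, K_ε ∘ K_ε ≡ 0, K_ε ∘ i_ε ≡ 0, and p_ε ∘ K_ε ≡ 0. -/
/-- Composition of first-order deformations, expanded in powers of the parameter. -/
theorem comp_add_smul_expand {R A B C : Type*} [CommRing R] [AddCommGroup A] [Module R A]
    [AddCommGroup B] [Module R B] [AddCommGroup C] [Module R C]
    (f f₁ : B →ₗ[R] C) (g g₁ : A →ₗ[R] B) (ε : R) :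
    (f + ε • f₁) ∘ₗ (g + ε • g₁) =
      f ∘ₗ g + ε • (f₁ ∘ₗ g + f ∘ₗ g₁) + ε ^ 2 • (f₁ ∘ₗ g₁) := by
  ext x
  simp only [LinearMap.comp_apply, LinearMap.add_apply, LinearMap.smul_apply, map_add, map_smul]
  module


/-- General infinitesimal deformation of SDR data `(i, p, K)` of a complex onto
its cohomology: with `𝕀 = K∘σ`, `Λ = K∘μ∘d∘K`, `ℙ = ρ∘d∘K` and first-order
corrections `i₁ = -(d∘𝕀∘i)`, `p₁ = -(p∘ℙ∘d)`,
`K₁ = d∘Λ - Λ∘d + (i∘p)∘ℙ + 𝕀∘(i∘p)`, the deformed triple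
`(i + ε•i₁, p + ε•p₁, K + ε•K₁)` satisfies all SDR axioms modulo `ε²`. -/
theorem stmt12
    {V W : Type*} [AddCommGroup V] [Module ℝ V] [AddCommGroup W] [Module ℝ W]
    (d : V →ₗ[ℝ] V) (hd : d ∘ₗ d = 0)
    (i : W →ₗ[ℝ] V) (p : V →ₗ[ℝ] W) (K : V →ₗ[ℝ] V)
    (hdi : d ∘ₗ i = 0) (hpd : p ∘ₗ d = 0)
    (hpi : p ∘ₗ i = LinearMap.id)
    (hK : d ∘ₗ K + K ∘ₗ d = LinearMap.id - i ∘ₗ p)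
    (hKK : K ∘ₗ K = 0) (hKi : K ∘ₗ i = 0) (hpK : p ∘ₗ K = 0)
    (σ μ ρ : V →ₗ[ℝ] V) :
    letI I : V →ₗ[ℝ] V := K ∘ₗ σ
    letI Λ : V →ₗ[ℝ] V := K ∘ₗ μ ∘ₗ d ∘ₗ K
    letI Pb : V →ₗ[ℝ] V := ρ ∘ₗ d ∘ₗ K
    letI i₁ : W →ₗ[ℝ] V := -(d ∘ₗ I ∘ₗ i)
    letI p₁ : V →ₗ[ℝ] W := -(p ∘ₗ Pb ∘ₗ d)
    letI K₁ : V →ₗ[ℝ] V := d ∘ₗ Λ - Λ ∘ₗ d + (i ∘ₗ p) ∘ₗ Pb + I ∘ₗ (i ∘ₗ p)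
    ∃ (E1 : W →ₗ[ℝ] V) (E2 : V →ₗ[ℝ] W) (E3 : W →ₗ[ℝ] W)
      (E4 : V →ₗ[ℝ] V) (E5 : V →ₗ[ℝ] V) (E6 : W →ₗ[ℝ] V) (E7 : V →ₗ[ℝ] W),
      ∀ ε : ℝ,
        d ∘ₗ (i + ε • i₁) = ε ^ 2 • E1 ∧
        (p + ε • p₁) ∘ₗ d = ε ^ 2 • E2 ∧
        (p + ε • p₁) ∘ₗ (i + ε • i₁) = LinearMap.id + ε ^ 2 • E3 ∧
        d ∘ₗ (K + ε • K₁) + (K + ε • K₁) ∘ₗ d =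
          (LinearMap.id - (i + ε • i₁) ∘ₗ (p + ε • p₁)) + ε ^ 2 • E4 ∧
        (K + ε • K₁) ∘ₗ (K + ε • K₁) = ε ^ 2 • E5 ∧
        (K + ε • K₁) ∘ₗ (i + ε • i₁) = ε ^ 2 • E6 ∧
        (p + ε • p₁) ∘ₗ (K + ε • K₁) = ε ^ 2 • E7 := by
  have hd' (x) : d (d x) = 0 := LinearMap.congr_fun hd x
  have hdi' (x) : d (i x) = 0 := LinearMap.congr_fun hdi x
  have hpd' (x) : p (d x) = 0 := LinearMap.congr_fun hpd x
  have hpi' (x) : p (i x) = x := LinearMap.congr_fun hpi x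
  have hKK' (x) : K (K x) = 0 := LinearMap.congr_fun hKK x
  have hKi' (x) : K (i x) = 0 := LinearMap.congr_fun hKi x
  have hpK' (x) : p (K x) = 0 := LinearMap.congr_fun hpK x
  have hKdK (x) : K (d (K x)) = K x := by
    simpa [hKK', hKi'] using congrArg K (LinearMap.congr_fun hK x)
  set i₁ : W →ₗ[ℝ] V := -(d ∘ₗ (K ∘ₗ σ) ∘ₗ i)
  set p₁ : V →ₗ[ℝ] W := -(p ∘ₗ (ρ ∘ₗ d ∘ₗ K) ∘ₗ d)
  set K₁ : V →ₗ[ℝ] V := d ∘ₗ (K ∘ₗ μ ∘ₗ d ∘ₗ K) - (K ∘ₗ μ ∘ₗ d ∘ₗ K) ∘ₗ d +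
    (i ∘ₗ p) ∘ₗ (ρ ∘ₗ d ∘ₗ K) + (K ∘ₗ σ) ∘ₗ (i ∘ₗ p)
  have closed : d ∘ₗ i₁ = 0 := by
    ext x; simp [i₁, hd']
  have exact_zero : p₁ ∘ₗ d = 0 := by
    ext x; simp [p₁, hd']
  have retract : p₁ ∘ₗ i + p ∘ₗ i₁ = 0 := by
    ext x; simp [p₁, i₁, hdi', hpd']
  have homotopy : d ∘ₗ K₁ + K₁ ∘ₗ d = -(i₁ ∘ₗ p + i ∘ₗ p₁) := by
    ext x
    simp only [K₁, i₁, p₁, LinearMap.comp_apply, LinearMap.add_apply, LinearMap.sub_apply,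
      LinearMap.neg_apply, map_add, map_sub, map_neg, map_zero, hd', hdi', hpd']
    abel
  have square : K₁ ∘ₗ K + K ∘ₗ K₁ = 0 := by
    ext x; simp [K₁, hKK', hKi', hpK', hKdK]
  have side_incl : K₁ ∘ₗ i + K ∘ₗ i₁ = 0 := by
    ext x; simp [K₁, i₁, hdi', hKi', hpi', hKdK]
  have side_proj : p₁ ∘ₗ K + p ∘ₗ K₁ = 0 := by
    ext x; simp [K₁, p₁, hpd', hpK', hpi', hKdK]
  refine ⟨0, 0, p₁ ∘ₗ i₁, i₁ ∘ₗ p₁, K₁ ∘ₗ K₁, K₁ ∘ₗ i₁, p₁ ∘ₗ K₁,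
    fun ε => ⟨?_, ?_, ?_, ?_, ?_, ?_, ?_⟩⟩
  · rw [LinearMap.comp_add, LinearMap.comp_smul, hdi, closed]; simp
  · rw [LinearMap.add_comp, LinearMap.smul_comp, hpd, exact_zero]; simp
  · rw [comp_add_smul_expand, hpi, retract, smul_zero, add_zero]
  · have expand : d ∘ₗ (K + ε • K₁) + (K + ε • K₁) ∘ₗ d =
        (d ∘ₗ K + K ∘ₗ d) + ε • (d ∘ₗ K₁ + K₁ ∘ₗ d) := by
      rw [LinearMap.comp_add, LinearMap.add_comp, LinearMap.comp_smul, LinearMap.smul_comp]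
      module
    rw [expand, hK, homotopy, comp_add_smul_expand]
    module
  · rw [comp_add_smul_expand, hKK, square, smul_zero, add_zero, zero_add]
  · rw [comp_add_smul_expand, hKi, side_incl, smul_zero, add_zero, zero_add]
  · rw [comp_add_smul_expand, hpK, side_proj, smul_zero, add_zero, zero_add]
end

section
/- Let E be a real Banach space, and let t ↦ Δ_t, t ↦ P_t and t ↦ G_t be maps from an open interval around 0 into the continuous linear endomorphisms of E, differentiable at 0 in the operator norm, such that for every t: P_t ∘ P_t = P_t, Δ_t ∘ P_t = P_t ∘ Δ_t = 0, and G_t ∘ (Δ_t + P_t) = (Δ_t + P_t) ∘ G_t = id_E. Then G_0 ∘ P_0 = P_0 ∘ G_0 = P_0, Δ_0 ∘ G_0 = G_0 ∘ Δ_0 = id_E − P_0, and the derivative of the projector at 0 is given by P_0' = −G_0 ∘ Δ_0' ∘ P_0 − P_0 ∘ Δ_0' ∘ G_0, where Δ_0' and P_0' denote the derivatives at t = 0. -/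
/-- The relations between a generalized Laplacian, its harmonic projector and its Green's
operator, in an arbitrary ring. -/
theorem green_projector_relations {R : Type*} [Ring R] {d p g : R} (hpp : p * p = p)
    (hdp : d * p = 0) (hpd : p * d = 0) (hg1 : g * (d + p) = 1) (hg2 : (d + p) * g = 1) :
    g * p = p ∧ p * g = p ∧ d * g = 1 - p ∧ g * d = 1 - p := by
  have hgp : g * p = p := by
    calc g * p = g * ((d + p) * p) := by rw [add_mul, hdp, hpp, zero_add]
      _ = p := by rw [← mul_assoc, hg1, one_mul]
  have hpg : p * g = p := by
    calc p * g = (p * (d + p)) * g := by rw [mul_add, hpd, hpp, zero_add]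
      _ = p := by rw [mul_assoc, hg2, mul_one]
  refine ⟨hgp, hpg, ?_, ?_⟩
  · rw [eq_sub_iff_add_eq, ← hg2, add_mul, hpg]
  · rw [eq_sub_iff_add_eq, ← hg1, mul_add, hgp]

/-- The first-order variation of a projector, from the linearized relations. -/
theorem projector_variation_of_linearized {R : Type*} [Ring R] {d p g d' p' : R}
    (hdg : d * g = 1 - p) (hgd : g * d = 1 - p) (hpp' : p' * p + p * p' = p')
    (hdp' : d' * p + d * p' = 0) (hpd' : p' * d + p * d' = 0) :
    p' = -(g * (d' * p)) - p * (d' * g) := by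
  have h1 : g * (d' * p) = -((1 - p) * p') := by
    rw [eq_neg_of_add_eq_zero_left hdp', mul_neg, ← mul_assoc, hgd]
  have h2 : p * (d' * g) = -(p' * (1 - p)) := by
    rw [← mul_assoc, eq_neg_of_add_eq_zero_right hpd', neg_mul, mul_assoc, hdg]
  calc p' = p' + p' - (p' * p + p * p') := by rw [hpp', add_sub_cancel_right]
    _ = -(g * (d' * p)) - p * (d' * g) := by rw [h1, h2]; noncomm_ring

/-- Variation of the harmonic projector: for differentiable families `Δ_t`
(generalized Laplacian), `P_t` (projector onto `ker Δ_t` along `im Δ_t`) and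
`G_t` (Green's operator, `G_t(Δ_t+P_t) = (Δ_t+P_t)G_t = id`), one has
`G₀P₀ = P₀G₀ = P₀`, `Δ₀G₀ = G₀Δ₀ = id - P₀`, and
`P₀' = -G₀ Δ₀' P₀ - P₀ Δ₀' G₀`. -/
theorem stmt13
    {E : Type*} [NormedAddCommGroup E] [NormedSpace ℝ E] [CompleteSpace E]
    (Δ P G : ℝ → (E →L[ℝ] E))
    (s : Set ℝ) (hs : IsOpen s) (h0s : (0 : ℝ) ∈ s)
    (hPP : ∀ t ∈ s, (P t).comp (P t) = P t)
    (hΔP : ∀ t ∈ s, (Δ t).comp (P t) = 0)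
    (hPΔ : ∀ t ∈ s, (P t).comp (Δ t) = 0)
    (hG1 : ∀ t ∈ s, (G t).comp (Δ t + P t) = ContinuousLinearMap.id ℝ E)
    (hG2 : ∀ t ∈ s, (Δ t + P t).comp (G t) = ContinuousLinearMap.id ℝ E)
    (Δ' P' : E →L[ℝ] E)
    (hΔd : HasDerivAt Δ Δ' 0)
    (hPd : HasDerivAt P P' 0)
    (hGd : DifferentiableAt ℝ G 0) :
    ((G 0).comp (P 0) = P 0) ∧
    ((P 0).comp (G 0) = P 0) ∧
    ((Δ 0).comp (G 0) = ContinuousLinearMap.id ℝ E - P 0) ∧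
    ((G 0).comp (Δ 0) = ContinuousLinearMap.id ℝ E - P 0) ∧
    (P' = -((G 0).comp (Δ'.comp (P 0))) - (P 0).comp (Δ'.comp (G 0))) := by
  have hs0 : s ∈ nhds (0 : ℝ) := hs.mem_nhds h0s
  obtain ⟨hgp, hpg, hdg, hgd⟩ := green_projector_relations (hPP 0 h0s) (hΔP 0 h0s) (hPΔ 0 h0s)
    (hG1 0 h0s) (hG2 0 h0s)
  have hpp' : P' * P 0 + P 0 * P' = P' :=
    (hPd.mul hPd).unique (hPd.congr_of_eventuallyEq (Filter.eventually_of_mem hs0 hPP))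
  have hdp' : Δ' * P 0 + Δ 0 * P' = 0 :=
    (hΔd.mul hPd).unique
      ((hasDerivAt_const (0 : ℝ) 0).congr_of_eventuallyEq (Filter.eventually_of_mem hs0 hΔP))
  have hpd' : P' * Δ 0 + P 0 * Δ' = 0 :=
    (hPd.mul hΔd).unique
      ((hasDerivAt_const (0 : ℝ) 0).congr_of_eventuallyEq (Filter.eventually_of_mem hs0 hPΔ))
  exact ⟨hgp, hpg, hdg, hgd, projector_variation_of_linearized hdg hgd hpp' hdp' hpd'⟩
end

section
/- Let E be a real Banach space, let h and A be fixed continuous linear endomorphisms of E with h ∘ h = 0, and let t ↦ Δ_t, P_t, G_t be operator-valued families, differentiable at 0 in the operator norm, such that for every t: P_t ∘ P_t = P_t, Δ_t ∘ P_t = P_t ∘ Δ_t = 0, G_t ∘ (Δ_t + P_t) = (Δ_t + P_t) ∘ G_t = id_E, h ∘ G_t = G_t ∘ h, and h ∘ P_t = P_t ∘ h = 0. Assume Δ_0' = h ∘ A + A ∘ h. Then, writing K_t = h ∘ G_t, the derivatives at 0 satisfy: P_0' = −K_0 ∘ A ∘ P_0 − P_0 ∘ A ∘ K_0 and K_0'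 = −K_0 ∘ A ∘ K_0. -/
/-- First-order form of the variation formulas, in an arbitrary ring: `Δ'`, `P'`, `G'` satisfy the
linearizations of the relations between `Δ`, `P`, `G` and `h`. -/
theorem variation_of_linearized_relations {R : Type*} [Ring R]
    {h A Δ P G Δ' P' G' : R} (hh : h * h = 0) (hPP : P * P = P)
    (hΔP : Δ * P = 0) (hPΔ : P * Δ = 0)
    (hG1 : G * (Δ + P) = 1) (hG2 : (Δ + P) * G = 1)
    (hhG : h * G = G * h) (hhP : h * P = 0) (hPh : P * h = 0)
    (dPP : P' * P + P * P' = P') (dΔP : Δ' * P + Δ * P' = 0) (dPΔ : P' * Δ + P * Δ' = 0)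
    (dG : G' * (Δ + P) + G * (Δ' + P') = 0) (dhP : h * P' = 0)
    (hΔ' : Δ' = h * A + A * h) :
    P' = -(h * G * (A * P)) - P * (A * (h * G)) ∧ h * G' = -(h * G * (A * (h * G))) := by
  have hGP : G * P = P := by
    calc G * P = G * (Δ * P + P * P) := by rw [hΔP, hPP, zero_add]
      _ = G * (Δ + P) * P := by noncomm_ring
      _ = P := by rw [hG1, one_mul]
  have hPG : P * G = P := by
    calc P * G = (P * Δ + P * P) * G := by rw [hPΔ, hPP, zero_add]
      _ = P * ((Δ + P) * G) := by noncomm_ring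
      _ = P := by rw [hG2, mul_one]
  have hGΔ : G * Δ = 1 - P := by
    rw [mul_add, hGP] at hG1
    exact eq_sub_of_add_eq hG1
  have hΔG : Δ * G = 1 - P := by
    rw [add_mul, hPG] at hG2
    exact eq_sub_of_add_eq hG2
  have hP'P : P' * P = -(h * G * (A * P)) := by
    calc P' * P = P' - P * P' := eq_sub_of_add_eq dPP
      _ = (1 - P) * P' := by noncomm_ring
      _ = G * (Δ * P') := by rw [← hGΔ, mul_assoc]
      _ = G * -(Δ' * P) := by rw [eq_neg_of_add_eq_zero_right dΔP]
      _ = -(G * h * (A * P)) - G * A * (h * P) := by rw [hΔ']; noncomm_ring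
      _ = -(h * G * (A * P)) := by rw [hhP, hhG, mul_zero, sub_zero]
  have hPP' : P * P' = -(P * (A * (h * G))) := by
    calc P * P' = P' - P' * P := eq_sub_of_add_eq' dPP
      _ = P' * (1 - P) := by noncomm_ring
      _ = P' * Δ * G := by rw [← hΔG, mul_assoc]
      _ = -(P * Δ') * G := by rw [eq_neg_of_add_eq_zero_left dPΔ]
      _ = -(P * (A * (h * G))) - P * h * (A * G) := by rw [hΔ']; noncomm_ring
      _ = -(P * (A * (h * G))) := by rw [hPh, zero_mul, sub_zero]
  refine ⟨by rw [← dPP, hP'P, hPP', sub_eq_add_neg], ?_⟩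
  calc h * G' = h * (G' * ((Δ + P) * G)) := by rw [hG2, mul_one]
    _ = h * (G' * (Δ + P)) * G := by noncomm_ring
    _ = -(h * G * (Δ' + P') * G) := by
        rw [eq_neg_of_add_eq_zero_left dG]; noncomm_ring
    _ = -(G * h * (Δ' + P') * G) := by rw [hhG]
    _ = -(G * (h * h) * A * G) - G * h * (A * (h * G)) - G * (h * P') * G := by
        rw [hΔ']; noncomm_ring
    _ = -(h * G * (A * (h * G))) := by rw [hh, dhP, ← hhG]; simp

/-- The product rule for a product agreeing near the base point with a differentiable function. -/
theorem HasDerivAt.mul_eq_of_eventuallyEq {R : Type*} [NormedRing R] [NormedAlgebra ℝ R]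
    {f g k : ℝ → R} {f' g' k' : R} {x : ℝ} (hf : HasDerivAt f f' x) (hg : HasDerivAt g g' x)
    (hk : HasDerivAt k k' x) (hfg : (fun t => f t * g t) =ᶠ[nhds x] k) :
    f' * g x + f x * g' = k' :=
  (hf.mul hg).unique (hk.congr_of_eventuallyEq hfg)


/-- Variation of the desynchronized Hodge data under a change of the kinetic
operator: if `Δ₀' = h∘A + A∘h` with `h² = 0`, `h` commuting with `G_t` and
annihilating `P_t`, then (with `K_t = h ∘ G_t`)
`P₀' = -K₀ A P₀ - P₀ A K₀` and `K₀' = -K₀ A K₀`. -/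
theorem stmt14
    {E : Type*} [NormedAddCommGroup E] [NormedSpace ℝ E] [CompleteSpace E]
    (h A : E →L[ℝ] E) (hh : h.comp h = 0)
    (Δ P G : ℝ → (E →L[ℝ] E))
    (s : Set ℝ) (hs : IsOpen s) (h0s : (0 : ℝ) ∈ s)
    (hPP : ∀ t ∈ s, (P t).comp (P t) = P t)
    (hΔP : ∀ t ∈ s, (Δ t).comp (P t) = 0)
    (hPΔ : ∀ t ∈ s, (P t).comp (Δ t) = 0)
    (hG1 : ∀ t ∈ s, (G t).comp (Δ t + P t) = ContinuousLinearMap.id ℝ E)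
    (hG2 : ∀ t ∈ s, (Δ t + P t).comp (G t) = ContinuousLinearMap.id ℝ E)
    (hhG : ∀ t ∈ s, h.comp (G t) = (G t).comp h)
    (hhP : ∀ t ∈ s, h.comp (P t) = 0)
    (hPh : ∀ t ∈ s, (P t).comp h = 0)
    (Δ' P' G' : E →L[ℝ] E)
    (hΔd : HasDerivAt Δ Δ' 0)
    (hPd : HasDerivAt P P' 0)
    (hGd : HasDerivAt G G' 0)
    (hΔ' : Δ' = h.comp A + A.comp h) :
    (P' = -((h.comp (G 0)).comp (A.comp (P 0)))
        - (P 0).comp (A.comp (h.comp (G 0)))) ∧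
    (h.comp G' = -((h.comp (G 0)).comp (A.comp (h.comp (G 0))))) := by
  have hs0 : s ∈ nhds (0 : ℝ) := hs.mem_nhds h0s
  have const (c : E →L[ℝ] E) : HasDerivAt (fun _ : ℝ => c) 0 0 := hasDerivAt_const 0 c
  have dhP := (const h).mul_eq_of_eventuallyEq hPd (const 0) (Filter.eventually_of_mem hs0 hhP)
  rw [zero_mul, zero_add] at dhP
  exact variation_of_linearized_relations hh (hPP 0 h0s) (hΔP 0 h0s) (hPΔ 0 h0s)
    (hG1 0 h0s) (hG2 0 h0s) (hhG 0 h0s) (hhP 0 h0s) (hPh 0 h0s)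
    (hPd.mul_eq_of_eventuallyEq hPd hPd (Filter.eventually_of_mem hs0 hPP))
    (hΔd.mul_eq_of_eventuallyEq hPd (const 0) (Filter.eventually_of_mem hs0 hΔP))
    (hPd.mul_eq_of_eventuallyEq hΔd (const 0) (Filter.eventually_of_mem hs0 hPΔ))
    (hGd.mul_eq_of_eventuallyEq (hΔd.add hPd) (const 1) (Filter.eventually_of_mem hs0 hG1))
    dhP hΔ'
end

section
/- Let E be a real Banach space and d a fixed continuous linear endomorphism with d ∘ d = 0. Let t ↦ h_t be a family of continuous endomorphisms, differentiable at 0 in the operator norm, with h_t ∘ h_t = 0 for all t, and set Δ_t = d ∘ h_t + h_t ∘ d. Let t ↦ P_t, G_t be operator families, differentiable at 0, such that for every t: P_t ∘ P_t = P_t, Δ_t ∘ P_t = P_t ∘ Δ_t = 0, G_t ∘ (Δ_t + P_t) = (Δ_t + P_t) ∘ G_t = id_E, d ∘ G_t = G_t ∘ d, h_t ∘ G_t = G_t ∘ h_t, d ∘ P_t = P_t ∘ d = 0, and h_t ∘ P_t = P_t ∘ h_t = 0. Write B = h_0' (the derivative at 0), K_t = h_t ∘ G_t and K† = d ∘ G_0,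 and assume there exists a linear map C : E → E with B ∘ P_0 = h_0 ∘ C. Then: P_0' = −K† ∘ B ∘ P_0 − P_0 ∘ B ∘ K†, and K_0' = d ∘ K_0 ∘ B ∘ G_0 − K_0 ∘ B ∘ G_0 ∘ d + P_0 ∘ B ∘ G_0 + G_0 ∘ B ∘ P_0. -/
/-- If `f * g` is eventually equal to a constant, the Leibniz rule expresses that its derivative
vanishes. -/
lemma HasDerivAt.leibniz_eq_zero_of_mul_eq_const {A : Type*} [NormedRing A] [NormedAlgebra ℝ A]
    {f g : ℝ → A} {f' g' c : A} {x : ℝ} {s : Set ℝ} (hs : s ∈ nhds x)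
    (hf : HasDerivAt f f' x) (hg : HasDerivAt g g' x) (hfg : ∀ t ∈ s, f t * g t = c) :
    f' * g x + f x * g' = 0 := by
  refine (hf.mul hg).unique ((hasDerivAt_const x c).congr_of_eventuallyEq ?_)
  filter_upwards [hs] with t ht using hfg t ht

/-- The derivative `P'` of the harmonic projector, from the linearized Hodge relations. -/
lemma harmonic_projector_variation {R : Type*} [Ring R] {d h P G B P' : R}
    (hG1 : G * (d * h + h * d + P) = 1) (hG2 : (d * h + h * d + P) * G = 1)
    (hdG : d * G = G * d) (hGP : G * P = P) (hPG : P * G = P)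
    (hPP' : P' * P + P * P' = P') (hdP' : d * P' = 0) (hPd' : P' * d = 0)
    (hhP' : B * P + h * P' = 0) (hPh' : P' * h + P * B = 0) :
    P' = -(d * G * (B * P)) - P * (B * (d * G)) := by
  have right : P' = P' * P - P * B * d * G := by
    calc P' = P' * ((d * h + h * d + P) * G) := by rw [hG2, mul_one]
      _ = P' * d * h * G + (P' * h + P * B) * d * G - P * B * d * G + P' * (P * G) := by
        noncomm_ring
      _ = P' * P - P * B * d * G := by rw [hPd', hPh', hPG]; noncomm_ring
  have left : P' = P * P' - d * G * B * P := by
    calc P' = G * (d * h + h * d + P) * P' := by rw [hG1, one_mul]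
      _ = G * d * (B * P + h * P') - G * d * B * P + G * h * (d * P') + G * P * P' := by
        noncomm_ring
      _ = P * P' - d * G * B * P := by rw [hhP', hdP', hGP, hdG]; noncomm_ring
  calc P' = P' + P' - (P' * P + P * P') := by rw [hPP']; noncomm_ring
    _ = (P' * P - P * B * d * G) + (P * P' - d * G * B * P) - (P' * P + P * P') := by
      rw [← right, ← left]
    _ = _ := by noncomm_ring

/-- The derivative `B * G + h * G'` of the chain homotopy, from the linearized Hodge relations. -/
lemma chain_homotopy_variation {R : Type*} [Ring R] {d h P G B P' G' : R}
    (hG1 : G * (d * h + h * d + P) = 1) (hG2 : (d * h + h * d + P) * G = 1)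
    (hdG : d * G = G * d) (hhG : h * G = G * h) (hGP : G * P = P) (hPG : P * G = P)
    (hhP' : B * P + h * P' = 0)
    (hG' : G' * (d * h + h * d + P) + G * (d * B + B * d + P') = 0) :
    B * G + h * G' = d * (h * G * (B * G)) - h * G * (B * (G * d)) + P * (B * G)
      + G * (B * P) := by
  have inverse : G' = -(G * (d * B + B * d + P') * G) := by
    calc G' = G' * ((d * h + h * d + P) * G) := by rw [hG2, mul_one]
      _ = (G' * (d * h + h * d + P) + G * (d * B + B * d + P')) * G
          - G * (d * B + B * d + P') * G := by noncomm_ring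
      _ = _ := by rw [hG']; noncomm_ring
  have split : h * G * d = 1 - P - d * (h * G) := by
    calc h * G * d = G * (d * h + h * d + P) - G * P - G * d * h := by
          rw [hhG]; noncomm_ring
      _ = 1 - P - d * (h * G) := by rw [hG1, hGP, ← hdG, hhG]; noncomm_ring
  have harmonic : h * G * P' * G = -(G * (B * P)) := by
    calc h * G * P' * G = G * (B * P + h * P') * G - G * B * (P * G) := by
          rw [hhG]; noncomm_ring
      _ = _ := by rw [hhP', hPG]; noncomm_ring
  calc B * G + h * G'
      = B * G - h * G * d * (B * G) - h * G * (B * (d * G)) - h * G * P' * G := by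
        rw [inverse]; noncomm_ring
    _ = _ := by rw [split, harmonic, hdG]; noncomm_ring


/-- Variation of the desynchronized Hodge data under a change of the
gauge-fixing operator `h_t` (with derivative `B = h₀'` satisfying
`B ∘ P₀ = h₀ ∘ C`): writing `K_t = h_t ∘ G_t` and `K† = d ∘ G₀`, one has
`P₀' = -K† B P₀ - P₀ B K†` and
`K₀' = d K₀ B G₀ - K₀ B G₀ d + P₀ B G₀ + G₀ B P₀`. -/
theorem stmt15
    {E : Type*} [NormedAddCommGroup E] [NormedSpace ℝ E] [CompleteSpace E]
    (d : E →L[ℝ] E) (hd : d.comp d = 0)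
    (h Δ P G : ℝ → (E →L[ℝ] E))
    (s : Set ℝ) (hs : IsOpen s) (h0s : (0 : ℝ) ∈ s)
    (hhh : ∀ t ∈ s, (h t).comp (h t) = 0)
    (hΔdef : ∀ t ∈ s, Δ t = d.comp (h t) + (h t).comp d)
    (hPP : ∀ t ∈ s, (P t).comp (P t) = P t)
    (hΔP : ∀ t ∈ s, (Δ t).comp (P t) = 0)
    (hPΔ : ∀ t ∈ s, (P t).comp (Δ t) = 0)
    (hG1 : ∀ t ∈ s, (G t).comp (Δ t + P t) = ContinuousLinearMap.id ℝ E)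
    (hG2 : ∀ t ∈ s, (Δ t + P t).comp (G t) = ContinuousLinearMap.id ℝ E)
    (hdG : ∀ t ∈ s, d.comp (G t) = (G t).comp d)
    (hhG : ∀ t ∈ s, (h t).comp (G t) = (G t).comp (h t))
    (hdP : ∀ t ∈ s, d.comp (P t) = 0)
    (hPd : ∀ t ∈ s, (P t).comp d = 0)
    (hhP : ∀ t ∈ s, (h t).comp (P t) = 0)
    (hPh : ∀ t ∈ s, (P t).comp (h t) = 0)
    (B P' G' : E →L[ℝ] E)
    (hhd : HasDerivAt h B 0)
    (hPd' : HasDerivAt P P' 0)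
    (hGd : HasDerivAt G G' 0)
    (C : E →ₗ[ℝ] E)
    (hBP : ∀ v : E, B ((P 0) v) = (h 0) (C v)) :
    (P' = -((d.comp (G 0)).comp (B.comp (P 0)))
        - (P 0).comp (B.comp (d.comp (G 0)))) ∧
    HasDerivAt (fun t => (h t).comp (G t))
      (d.comp (((h 0).comp (G 0)).comp (B.comp (G 0)))
        - ((h 0).comp (G 0)).comp (B.comp ((G 0).comp d))
        + (P 0).comp (B.comp (G 0))
        + (G 0).comp (B.comp (P 0))) 0 := by
  have hs0 : s ∈ nhds (0 : ℝ) := hs.mem_nhds h0s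
  have hconst : HasDerivAt (fun _ : ℝ => d) 0 0 := hasDerivAt_const 0 d
  have hΔP0 : (d * h 0 + h 0 * d) * P 0 = 0 := by
    have := hΔP 0 h0s
    rwa [hΔdef 0 h0s] at this
  have hPΔ0 : P 0 * (d * h 0 + h 0 * d) = 0 := by
    have := hPΔ 0 h0s
    rwa [hΔdef 0 h0s] at this
  have hPP0 : P 0 * P 0 = P 0 := hPP 0 h0s
  have hG10 : G 0 * (d * h 0 + h 0 * d + P 0) = 1 := by
    have := hG1 0 h0s
    rwa [hΔdef 0 h0s] at this
  have hG20 : (d * h 0 + h 0 * d + P 0) * G 0 = 1 := by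
    have := hG2 0 h0s
    rwa [hΔdef 0 h0s] at this
  have hGP : G 0 * P 0 = P 0 := by
    calc G 0 * P 0 = G 0 * ((d * h 0 + h 0 * d + P 0) * P 0) := by
          rw [add_mul, hΔP0, hPP0, zero_add]
      _ = P 0 := by rw [← mul_assoc, hG10, one_mul]
  have hPG : P 0 * G 0 = P 0 := by
    calc P 0 * G 0 = P 0 * (d * h 0 + h 0 * d + P 0) * G 0 := by
          rw [mul_add, hPΔ0, hPP0, zero_add]
      _ = P 0 := by rw [mul_assoc, hG20, mul_one]
  have hPP' : P' * P 0 + P 0 * P' = P' := by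
    refine (hPd'.mul hPd').unique (hPd'.congr_of_eventuallyEq ?_)
    filter_upwards [hs0] with t ht using hPP t ht
  have hdP' : d * P' = 0 := by
    simpa using hconst.leibniz_eq_zero_of_mul_eq_const hs0 hPd' hdP
  have hP'd : P' * d = 0 := by
    simpa using hPd'.leibniz_eq_zero_of_mul_eq_const hs0 hconst hPd
  have hhP' : B * P 0 + h 0 * P' = 0 := hhd.leibniz_eq_zero_of_mul_eq_const hs0 hPd' hhP
  have hPh' : P' * h 0 + P 0 * B = 0 := hPd'.leibniz_eq_zero_of_mul_eq_const hs0 hhd hPh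
  have hΔ' : HasDerivAt (fun t => d * h t + h t * d + P t) (d * B + B * d + P') 0 :=
    ((hhd.const_mul d).add (hhd.mul_const d)).add hPd'
  have hG' : G' * (d * h 0 + h 0 * d + P 0) + G 0 * (d * B + B * d + P') = 0 := by
    refine hGd.leibniz_eq_zero_of_mul_eq_const (c := 1) hs0 hΔ' fun t ht => ?_
    have := hG1 t ht
    rwa [hΔdef t ht] at this
  refine ⟨harmonic_projector_variation hG10 hG20 (hdG 0 h0s) hGP hPG hPP' hdP' hP'd hhP' hPh', ?_⟩
  exact (hhd.mul hGd).congr_deriv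
    (chain_homotopy_variation hG10 hG20 (hdG 0 h0s) (hhG 0 h0s) hGP hPG hhP' hG')
end

section
/- Let E be a real Banach space, d a fixed continuous linear endomorphism with d ∘ d = 0, and λ a fixed continuous linear endomorphism. Let t ↦ h_t be a family of continuous endomorphisms, differentiable at 0 in the operator norm, with h_t ∘ h_t = 0 for all t and with derivative h_0' = h_0 ∘ λ − λ ∘ h_0. Set Δ_t = d ∘ h_t + h_t ∘ d and let t ↦ P_t, G_t be differentiable operator families such that for every t: P_t ∘ P_t = P_t, Δ_t ∘ P_t = P_t ∘ Δ_t = 0, G_t ∘ (Δ_t + P_t) = (Δ_t + P_t) ∘ G_t = id_E, d ∘ G_t = G_t ∘ d, h_t ∘ G_t = G_t ∘ h_t, d ∘ P_t = P_t ∘ d = 0, and h_t ∘ P_t = P_t ∘ h_t = 0. Write K_t = h_t ∘ G_t, and drop the subscript 0 on the operators appearing on the right-hand sides. Then: P_0' = −d ∘ K ∘ λ ∘ P + P ∘ λ ∘ K ∘ d, and K_0' = −d ∘ K ∘ λ ∘ K + K ∘ λ ∘ K ∘ d − P ∘ λ ∘ K + K ∘ λ ∘ P. -/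
section Algebra

variable {R : Type*} [Ring R] {d h l P G P' G' : R}

/-- The first-order variation of the harmonic projector, from the linearised identities. -/
theorem projector_variation
    (hG1 : G * (d * h + h * d + P) = 1) (hG2 : (d * h + h * d + P) * G = 1)
    (hdG : d * G = G * d) (hhG : h * G = G * h) (hGP : G * P = P) (hPG : P * G = P)
    (hPP' : P' * P + P * P' = P') (hdP' : d * P' = 0) (hP'd : P' * d = 0)
    (hhP' : h * P' = -(h * l * P)) (hP'h : P' * h = P * l * h) :
    P' = -(d * (h * G * (l * P))) + P * (l * (h * G * d)) := by
  have left : P' - P * P' = -(d * (h * G * (l * P))) := by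
    linear_combination (norm := noncomm_ring) -(hG1 * P') + G * d * hhP' + G * h * hdP'
      + hGP * P' + hdG * h * l * P + d * hhG * l * P
  have right : P' - P' * P = P * (l * (h * G * d)) := by
    linear_combination (norm := noncomm_ring) -(P' * hG2) + hP'd * h * G + hP'h * d * G
      + P' * hPG + P * l * h * hdG
  linear_combination (norm := noncomm_ring) left + right + hPP'

/-- The first-order variation of the chain homotopy, from the linearised identities. -/
theorem homotopy_variation
    (hhh : h * h = 0)
    (hG1 : G * (d * h + h * d + P) = 1) (hG2 : (d * h + h * d + P) * G = 1)
    (hdG : d * G = G * d) (hhG : h * G = G * h) (hGP : G * P = P) (hPG : P * G = P)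
    (hPh : P * h = 0) (hhP' : h * P' = -(h * l * P))
    (hG' : G' * (d * h + h * d + P)
      + G * (d * (h * l - l * h) + (h * l - l * h) * d + P') = 0) :
    (h * l - l * h) * G + h * G' =
      -(d * (h * G * (l * (h * G)))) + h * G * (l * (h * G * d))
        - P * (l * (h * G)) + h * G * (l * P) := by
  have hG'_eq : G' = -(G * (d * (h * l - l * h) + (h * l - l * h) * d + P') * G) := by
    linear_combination (norm := noncomm_ring) hG' * G - G' * hG2
  have hKh : h * G * h = 0 := by
    linear_combination (norm := noncomm_ring) hhG * h + G * hhh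
  have hKP' : h * G * P' = -(h * G * l * P) := by
    linear_combination (norm := noncomm_ring) hhG * P' + G * hhP' + hhG * l * P
  have hKd : h * G * d = 1 - P - d * h * G := by
    linear_combination (norm := noncomm_ring) hhG * d + hG1 - hGP + hdG * h + d * hhG
  have hKdh : h * G * d * h = h := by
    linear_combination (norm := noncomm_ring) hKd * h - hPh - d * hKh
  rw [hG'_eq]
  linear_combination (norm := noncomm_ring) -(hKdh * l * G) + hKd * l * h * G
    - hKh * l * d * G - hKP' * G + h * G * l * hPG + h * G * l * h * hdG

end Algebra

/-- The product rule for a product of two operator families that is locally constant. -/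
theorem HasDerivAt.mul_add_mul_eq_zero_of_eventuallyEq_const
    {A : Type*} [NormedRing A] [NormedAlgebra ℝ A] {f g : ℝ → A} {f' g' c : A} {x : ℝ}
    (hf : HasDerivAt f f' x) (hg : HasDerivAt g g' x)
    (hfg : ∀ᶠ t in nhds x, f t * g t = c) :
    f' * g x + f x * g' = 0 :=
  (hf.mul hg).unique ((hasDerivAt_const x c).congr_of_eventuallyEq hfg)


/-- Metric dependence of the Hodge SDR data: if the gauge-fixing family `h_t`
(square-zero) has derivative `h₀' = h₀∘λ - λ∘h₀`, then with `K = h₀ ∘ G₀`,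
`P = P₀` one has `P₀' = -d K λ P + P λ K d` and
`K₀' = -d K λ K + K λ K d - P λ K + K λ P`. -/
theorem stmt16
    {E : Type*} [NormedAddCommGroup E] [NormedSpace ℝ E] [CompleteSpace E]
    (d : E →L[ℝ] E) (hd : d.comp d = 0)
    (l : E →L[ℝ] E)
    (h Δ P G : ℝ → (E →L[ℝ] E))
    (s : Set ℝ) (hs : IsOpen s) (h0s : (0 : ℝ) ∈ s)
    (hhh : ∀ t ∈ s, (h t).comp (h t) = 0)
    (hΔdef : ∀ t ∈ s, Δ t = d.comp (h t) + (h t).comp d)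
    (hPP : ∀ t ∈ s, (P t).comp (P t) = P t)
    (hΔP : ∀ t ∈ s, (Δ t).comp (P t) = 0)
    (hPΔ : ∀ t ∈ s, (P t).comp (Δ t) = 0)
    (hG1 : ∀ t ∈ s, (G t).comp (Δ t + P t) = ContinuousLinearMap.id ℝ E)
    (hG2 : ∀ t ∈ s, (Δ t + P t).comp (G t) = ContinuousLinearMap.id ℝ E)
    (hdG : ∀ t ∈ s, d.comp (G t) = (G t).comp d)
    (hhG : ∀ t ∈ s, (h t).comp (G t) = (G t).comp (h t))
    (hdP : ∀ t ∈ s, d.comp (P t) = 0)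
    (hPd : ∀ t ∈ s, (P t).comp d = 0)
    (hhP : ∀ t ∈ s, (h t).comp (P t) = 0)
    (hPh : ∀ t ∈ s, (P t).comp (h t) = 0)
    (P' G' : E →L[ℝ] E)
    (hhd : HasDerivAt h ((h 0).comp l - l.comp (h 0)) 0)
    (hPd' : HasDerivAt P P' 0)
    (hGd : HasDerivAt G G' 0) :
    (P' = -(d.comp (((h 0).comp (G 0)).comp (l.comp (P 0))))
        + (P 0).comp (l.comp (((h 0).comp (G 0)).comp d))) ∧
    HasDerivAt (fun t => (h t).comp (G t))
      (-(d.comp (((h 0).comp (G 0)).comp (l.comp ((h 0).comp (G 0)))))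
        + ((h 0).comp (G 0)).comp (l.comp (((h 0).comp (G 0)).comp d))
        - (P 0).comp (l.comp ((h 0).comp (G 0)))
        + ((h 0).comp (G 0)).comp (l.comp (P 0))) 0 := by
  simp only [← ContinuousLinearMap.mul_def] at *
  rw [← ContinuousLinearMap.one_def] at hG1 hG2
  have hs' : ∀ᶠ t in nhds (0 : ℝ), t ∈ s := hs.mem_nhds h0s
  have hd_const := hasDerivAt_const (0 : ℝ) d
  have hG1₀ := hG1 0 h0s
  have hG2₀ := hG2 0 h0s
  rw [hΔdef 0 h0s] at hG1₀ hG2₀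
  have hGP : G 0 * P 0 = P 0 := by
    linear_combination (norm := noncomm_ring)
      hG1 0 h0s * P 0 - G 0 * hΔP 0 h0s - G 0 * hPP 0 h0s
  have hPG : P 0 * G 0 = P 0 := by
    linear_combination (norm := noncomm_ring)
      P 0 * hG2 0 h0s - hPΔ 0 h0s * G 0 - hPP 0 h0s * G 0
  have hPP' : P' * P 0 + P 0 * P' = P' :=
    (hPd'.mul hPd').unique (hPd'.congr_of_eventuallyEq (hs'.mono hPP))
  have hdP' : d * P' = 0 := by
    simpa using hd_const.mul_add_mul_eq_zero_of_eventuallyEq_const hPd' (hs'.mono hdP)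
  have hP'd : P' * d = 0 := by
    simpa using hPd'.mul_add_mul_eq_zero_of_eventuallyEq_const hd_const (hs'.mono hPd)
  have hhP' : h 0 * P' = -(h 0 * l * P 0) := by
    linear_combination (norm := noncomm_ring)
      hhd.mul_add_mul_eq_zero_of_eventuallyEq_const hPd' (hs'.mono hhP) + l * hhP 0 h0s
  have hP'h : P' * h 0 = P 0 * l * h 0 := by
    linear_combination (norm := noncomm_ring)
      hPd'.mul_add_mul_eq_zero_of_eventuallyEq_const hhd (hs'.mono hPh) - hPh 0 h0s * l
  have hΔ' : HasDerivAt (fun t => d * h t + h t * d + P t)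
      (d * (h 0 * l - l * h 0) + (h 0 * l - l * h 0) * d + P') 0 :=
    ((hhd.const_mul d).add (hhd.mul_const d)).add hPd'
  have hG' := hGd.mul_add_mul_eq_zero_of_eventuallyEq_const hΔ'
    (hs'.mono fun t ht => hΔdef t ht ▸ hG1 t ht)
  refine ⟨projector_variation hG1₀ hG2₀ (hdG 0 h0s) (hhG 0 h0s) hGP hPG hPP' hdP' hP'd
    hhP' hP'h, ?_⟩
  rw [← homotopy_variation (hhh 0 h0s) hG1₀ hG2₀ (hdG 0 h0s) (hhG 0 h0s) hGP hPG
    (hPh 0 h0s) hhP' hG']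
  exact hhd.mul hGd
end
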